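/- arXiv:2210.00490 — 7 statements merged into one kernel-verified Lean document; each statement's English description precedes it below -/
import Mathlib

section
/- For real parameters ρ, α, b, Q with 0 < ρ < 1, α > 0, b > 0, Q > 0, and any real numbers M, S, there exists a real number S' such that for every real W, the minimum over p ∈ ℝ of g(p) = W² + (α/b)p² + ρ(Q(W + 1 − (α/b)p)² + M(W + 1 − (α/b)p) + S) equals Q'W² + M'W + S', where Q' = 1 + ρQ/(1 + ρQ(α/b)) and M' = ρ(M + 2Q)/(1 + ρQ(α/b)). -/
/-- Completing the square in `p` for the one-step objective, with `c` in place of `α / b`. -/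
theorem stage_cost_eq_add_sq (ρ c Q M S W p : ℝ) (hD : 1 + ρ * Q * c ≠ 0) :
    W ^ 2 + c * p ^ 2 + ρ * (Q * (W + 1 - c * p) ^ 2 + M * (W + 1 - c * p) + S) =
      (1 + ρ * Q / (1 + ρ * Q * c)) * W ^ 2 + (ρ * (M + 2 * Q) / (1 + ρ * Q * c)) * W +
        (ρ * S + (ρ * (Q + M) - c * ρ ^ 2 * M ^ 2 / 4) / (1 + ρ * Q * c)) +
      c * (1 + ρ * Q * c) * (p - ρ * (Q * (W + 1) + M / 2) / (1 + ρ * Q * c)) ^ 2 := by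
  generalize hd : 1 + ρ * Q * c = d at hD ⊢
  field_simp
  subst hd
  ring

/-- Riccati-type recursion step: if the continuation value is
`V(w) = Qw² + Mw + S`, then the minimum over `p ∈ ℝ` of the one-step objective
is again quadratic in `W`, with leading coefficient `Q' = 1 + ρQ/(1 + ρQ(α/b))`
and linear coefficient `M' = ρ(M + 2Q)/(1 + ρQ(α/b))`. -/
theorem stmt_2 (ρ α b Q M S : ℝ)
    (hρ : 0 < ρ) (hρ1 : ρ < 1) (hα : 0 < α) (hb : 0 < b) (hQ : 0 < Q) :
    ∃ S' : ℝ, ∀ W : ℝ,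
      IsLeast (Set.range (fun p : ℝ => W ^ 2 + (α / b) * p ^ 2 +
          ρ * (Q * (W + 1 - (α / b) * p) ^ 2 + M * (W + 1 - (α / b) * p) + S)))
        ((1 + ρ * Q / (1 + ρ * Q * (α / b))) * W ^ 2 +
          (ρ * (M + 2 * Q) / (1 + ρ * Q * (α / b))) * W + S') := by
  have hc : 0 < α / b := div_pos hα hb
  generalize α / b = c at hc ⊢
  have hD : 0 < 1 + ρ * Q * c := by positivity
  refine ⟨ρ * S + (ρ * (Q + M) - c * ρ ^ 2 * M ^ 2 / 4) / (1 + ρ * Q * c), fun W => ⟨?_, ?_⟩⟩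
  · refine ⟨ρ * (Q * (W + 1) + M / 2) / (1 + ρ * Q * c), ?_⟩
    beta_reduce
    rw [stage_cost_eq_add_sq ρ c Q M S W _ hD.ne', sub_self]
    ring
  · rintro _ ⟨p, rfl⟩
    beta_reduce
    rw [stage_cost_eq_add_sq ρ c Q M S W p hD.ne']
    exact le_add_of_nonneg_right (by positivity)
end

section
/- Fix real parameters ρ, α, b with 0 < ρ < 1, α > 0, b > 0, define f(x) = 1 + ρx/(1 + ρx(α/b)), and define the sequence (q_n) by q_0 = 1 and q_{n+1} = f(q_n). Then (q_n) converges, and its limit is Q* = (1/2)(1 − b(1−ρ)/(ρα) + √((1 − b(1−ρ)/(ρα))² + 4b/(ρα))). -/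
/-- The Riccati map `x ↦ 1 + ρ x / (1 + ρ x c)` is a `ρ`-contraction on the nonnegative reals. -/
lemma abs_riccati_sub_le {ρ c x y : ℝ} (hρ : 0 ≤ ρ) (hc : 0 ≤ c) (hx : 0 ≤ x) (hy : 0 ≤ y) :
    |(1 + ρ * x / (1 + ρ * x * c)) - (1 + ρ * y / (1 + ρ * y * c))| ≤ ρ * |x - y| := by
  have hX : 1 ≤ 1 + ρ * x * c := le_add_of_nonneg_right (by positivity)
  have hY : 1 ≤ 1 + ρ * y * c := le_add_of_nonneg_right (by positivity)
  have hXY : 1 ≤ (1 + ρ * x * c) * (1 + ρ * y * c) := one_le_mul_of_one_le_of_one_le hX hY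
  have h : (1 + ρ * x / (1 + ρ * x * c)) - (1 + ρ * y / (1 + ρ * y * c)) =
      ρ * (x - y) / ((1 + ρ * x * c) * (1 + ρ * y * c)) := by
    field_simp
    ring
  rw [h, abs_div, abs_mul, abs_of_nonneg hρ, abs_of_pos (zero_lt_one.trans_le hXY)]
  exact div_le_self (by positivity) hXY

/-- The larger root of `x ^ 2 = A x + B` with `B > 0` is positive. -/
lemma half_add_sqrt_pos {A B : ℝ} (hB : 0 < B) : 0 < 1 / 2 * (A + √(A ^ 2 + 4 * B)) := by
  have h : |A| < √(A ^ 2 + 4 * B) := by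
    rw [← Real.sqrt_sq_eq_abs]
    exact Real.sqrt_lt_sqrt (sq_nonneg A) (by linarith)
  linarith [neg_abs_le A]

lemma half_add_sqrt_sq {A B : ℝ} (hB : 0 ≤ B) :
    (1 / 2 * (A + √(A ^ 2 + 4 * B))) ^ 2 = A * (1 / 2 * (A + √(A ^ 2 + 4 * B))) + B := by
  have h := Real.sq_sqrt (show 0 ≤ A ^ 2 + 4 * B by positivity)
  linear_combination h / 4

/-- A nonnegative root of the stationary quadratic is a fixed point of the Riccati map. -/
lemma riccati_fixed_of_sq_eq {ρ α b x : ℝ} (hρ : 0 < ρ) (hα : 0 < α) (hb : 0 < b) (hx : 0 ≤ x)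
    (h : x ^ 2 = (1 - b * (1 - ρ) / (ρ * α)) * x + b / (ρ * α)) :
    1 + ρ * x / (1 + ρ * x * (α / b)) = x := by
  field_simp at h
  have hd : b + ρ * x * α ≠ 0 := by positivity
  have he : 1 + ρ * x * (α / b) = (b + ρ * x * α) / b := by field_simp
  rw [he]
  field_simp
  linear_combination -h

/-- Convergence of the time-reversed Riccati sequence (Lemma 3.1): `q_n`
converges to the steady state `Q*` of equation (16). -/
theorem stmt_7 (ρ α b : ℝ) (hρ : 0 < ρ) (hρ1 : ρ < 1) (hα : 0 < α) (hb : 0 < b)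
    (q : ℕ → ℝ) (hq0 : q 0 = 1)
    (hqrec : ∀ n, q (n + 1) = 1 + ρ * q n / (1 + ρ * q n * (α / b))) :
    Filter.Tendsto q Filter.atTop (nhds
      ((1 / 2) * (1 - b * (1 - ρ) / (ρ * α) +
        Real.sqrt ((1 - b * (1 - ρ) / (ρ * α)) ^ 2 + 4 * b / (ρ * α))))) := by
  have hB : 0 < b / (ρ * α) := by positivity
  rw [mul_div_assoc 4 b]
  set Q := (1 / 2) * (1 - b * (1 - ρ) / (ρ * α) +
    Real.sqrt ((1 - b * (1 - ρ) / (ρ * α)) ^ 2 + 4 * (b / (ρ * α))))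
  have hQ : 0 ≤ Q := (half_add_sqrt_pos hB).le
  have hfix : 1 + ρ * Q / (1 + ρ * Q * (α / b)) = Q :=
    riccati_fixed_of_sq_eq hρ hα hb hQ (half_add_sqrt_sq hB.le)
  have hq : ∀ n, 0 ≤ q n := by
    intro n
    induction n with
    | zero => simp [hq0]
    | succ n ih => rw [hqrec]; positivity
  have hbound : ∀ n, |q n - Q| ≤ ρ ^ n * |q 0 - Q| := by
    intro n
    induction n with
    | zero => simp
    | succ n ih =>
      calc |q (n + 1) - Q| ≤ ρ * |q n - Q| := by
            have h := abs_riccati_sub_le hρ.le (div_pos hα hb).le (hq n) hQ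
            rwa [hfix, ← hqrec] at h
        _ ≤ ρ * (ρ ^ n * |q 0 - Q|) := by gcongr
        _ = ρ ^ (n + 1) * |q 0 - Q| := by ring
  rw [tendsto_iff_dist_tendsto_zero]
  refine squeeze_zero (fun n => dist_nonneg) hbound ?_
  simpa using (tendsto_pow_atTop_nhds_zero_of_lt_one hρ.le hρ1).mul_const |q 0 - Q|
end

section
/- Fix real parameters ρ, α, b with 0 < ρ < 1, α > 0, b > 0. Define f(x) = 1 + ρx/(1 + ρx(α/b)), the sequence (q_n) by q_0 = 1 and q_{n+1} = f(q_n), and the sequence (m_n) by m_0 = 0 and m_{n+1} = ρ(m_n + 2q_n)/(1 + ρq_n(α/b)). Let Q* = (1/2)(1 − b(1−ρ)/(ρα) + √((1 − b(1−ρ)/(ρα))² + 4b/(ρα))) and M* = 2ρQ*/(1 − ρ + ρQ*(α/b)). Then (m_n) is monotone increasing and m_n ≤ M* for every n ≥ 0. -/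
/-- The map `x ↦ 1 + ρx / (1 + ρxc)` is increasing on the nonnegative reals. -/
lemma riccati_map_le {ρ c x y : ℝ} (hρ : 0 < ρ) (hc : 0 < c) (hx : 0 ≤ x) (hxy : x ≤ y) :
    1 + ρ * x / (1 + ρ * x * c) ≤ 1 + ρ * y / (1 + ρ * y * c) := by
  have hy : 0 ≤ y := hx.trans hxy
  have h : ρ * x / (1 + ρ * x * c) ≤ ρ * y / (1 + ρ * y * c) := by
    rw [div_le_div_iff₀ (by positivity) (by positivity)]
    nlinarith [mul_le_mul_of_nonneg_left hxy hρ.le]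
  linarith

/-- The map `(u, x) ↦ ρ(u + 2x) / (1 + ρxc)` is increasing in both variables as long as
`ρcu ≤ 2`. -/
lemma linear_map_le {ρ c u v x y : ℝ} (hρ : 0 < ρ) (hc : 0 < c) (hx : 0 ≤ x) (hxy : x ≤ y)
    (huv : u ≤ v) (hu : ρ * c * u ≤ 2) :
    ρ * (u + 2 * x) / (1 + ρ * x * c) ≤ ρ * (v + 2 * y) / (1 + ρ * y * c) := by
  have hy : 0 ≤ y := hx.trans hxy
  calc
    ρ * (u + 2 * x) / (1 + ρ * x * c) ≤ ρ * (u + 2 * y) / (1 + ρ * y * c) := by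
      rw [div_le_div_iff₀ (by positivity) (by positivity)]
      nlinarith [mul_nonneg hρ.le (mul_nonneg (sub_nonneg.2 hxy) (sub_nonneg.2 hu))]
    _ ≤ ρ * (v + 2 * y) / (1 + ρ * y * c) := by gcongr

/-- If `Q` is a positive fixed point of the recursion of `q`, then `m` is increasing and bounded
by the corresponding fixed point of its own recursion. -/
lemma monotone_and_le_steady_state {ρ c Q : ℝ} (hρ : 0 < ρ) (hρ1 : ρ < 1) (hc : 0 < c)
    (hQ : 0 < Q) (hQfix : Q = 1 + ρ * Q / (1 + ρ * Q * c)) {q m : ℕ → ℝ} (hq0 : q 0 = 1)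
    (hqrec : ∀ n, q (n + 1) = 1 + ρ * q n / (1 + ρ * q n * c)) (hm0 : m 0 = 0)
    (hmrec : ∀ n, m (n + 1) = ρ * (m n + 2 * q n) / (1 + ρ * q n * c)) :
    Monotone m ∧ ∀ n, m n ≤ 2 * ρ * Q / (1 - ρ + ρ * Q * c) := by
  have hq : ∀ n, 0 < q n := by
    intro n
    induction n with
    | zero => simp [hq0]
    | succ n ih => rw [hqrec]; positivity
  have hqmono : ∀ n, q n ≤ q (n + 1) := by
    intro n
    induction n with
    | zero =>
      rw [hqrec, hq0, le_add_iff_nonneg_right]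
      positivity
    | succ n ih =>
      rw [hqrec n, hqrec (n + 1)]
      exact riccati_map_le hρ hc (hq n).le ih
  have hqQ : ∀ n, q n ≤ Q := by
    intro n
    induction n with
    | zero =>
      rw [hq0, hQfix, le_add_iff_nonneg_right]
      positivity
    | succ n ih =>
      rw [hqrec n, hQfix]
      exact riccati_map_le hρ hc (hq n).le ih
  have hden : 0 < 1 - ρ + ρ * Q * c := by
    have : 0 < ρ * Q * c := by positivity
    linarith
  set M := 2 * ρ * Q / (1 - ρ + ρ * Q * c) with hM
  have hMfix : ρ * (M + 2 * Q) / (1 + ρ * Q * c) = M := by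
    rw [div_eq_iff (by positivity), hM]
    field_simp
    ring
  have hM2 : ρ * c * M ≤ 2 := by
    rw [hM, mul_div_assoc', div_le_iff₀ hden]
    nlinarith [mul_le_mul_of_nonneg_right hρ1.le (show 0 ≤ ρ * Q * c by positivity)]
  have hmM : ∀ n, m n ≤ M := by
    intro n
    induction n with
    | zero => rw [hm0]; positivity
    | succ n ih =>
      rw [hmrec, ← hMfix]
      exact linear_map_le hρ hc (hq n).le (hqQ n) ih
        ((mul_le_mul_of_nonneg_left ih (by positivity)).trans hM2)
  refine ⟨monotone_nat_of_le_succ fun n => ?_, hmM⟩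
  induction n with
  | zero =>
    have := hq 0
    rw [hmrec, hm0]
    positivity
  | succ n ih =>
    rw [hmrec n, hmrec (n + 1)]
    exact linear_map_le hρ hc (hq n).le (hqmono n) ih
      ((mul_le_mul_of_nonneg_left (hmM n) (by positivity)).trans hM2)

/-- The time-reversed sequence `m_n` of the backward recursion
`M_t = ρ(M_{t+1} + 2Q_{t+1})/(1 + ρQ_{t+1}(α/b))` with `m_0 = 0` is monotone
increasing and bounded above by the steady state `M*` (Lemma 3.1). -/
theorem stmt_11 (ρ α b : ℝ) (hρ : 0 < ρ) (hρ1 : ρ < 1) (hα : 0 < α) (hb : 0 < b)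
    (q m : ℕ → ℝ) (hq0 : q 0 = 1)
    (hqrec : ∀ n, q (n + 1) = 1 + ρ * q n / (1 + ρ * q n * (α / b)))
    (hm0 : m 0 = 0)
    (hmrec : ∀ n, m (n + 1) = ρ * (m n + 2 * q n) / (1 + ρ * q n * (α / b))) :
    Monotone m ∧
    ∀ n, m n ≤ 2 * ρ * ((1 / 2) * (1 - b * (1 - ρ) / (ρ * α) +
          Real.sqrt ((1 - b * (1 - ρ) / (ρ * α)) ^ 2 + 4 * b / (ρ * α)))) /
        (1 - ρ + ρ * ((1 / 2) * (1 - b * (1 - ρ) / (ρ * α) +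
          Real.sqrt ((1 - b * (1 - ρ) / (ρ * α)) ^ 2 + 4 * b / (ρ * α)))) *
          (α / b)) := by
  have hD : 0 < 4 * b / (ρ * α) := by positivity
  set a := 1 - b * (1 - ρ) / (ρ * α) with ha
  set s := Real.sqrt (a ^ 2 + 4 * b / (ρ * α))
  have hs : s ^ 2 = a ^ 2 + 4 * b / (ρ * α) := Real.sq_sqrt (by positivity)
  have hpos : 0 < (1 / 2) * (a + s) := by
    have : |a| < s := Real.lt_sqrt_of_sq_lt (by rw [sq_abs]; linarith)
    linarith [neg_abs_le a]
  set Q := (1 / 2) * (a + s) with hQ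
  refine monotone_and_le_steady_state hρ hρ1 (div_pos hα hb) hpos ?_ hq0 hqrec hm0 hmrec
  have hquad : Q ^ 2 = a * Q + b / (ρ * α) := by
    rw [hQ]
    linear_combination (1 / 4) * hs
  rw [ha] at hquad
  field_simp at hquad ⊢
  linear_combination hquad
end

section
/- Fix real parameters ρ, α, b with 0 < ρ < 1, α > 0, b > 0. Define f(x) = 1 + ρx/(1 + ρx(α/b)), the sequence (q_n) by q_0 = 1 and q_{n+1} = f(q_n), and the sequence (m_n) by m_0 = 0 and m_{n+1} = ρ(m_n + 2q_n)/(1 + ρq_n(α/b)). Let Q* = (1/2)(1 − b(1−ρ)/(ρα) + √((1 − b(1−ρ)/(ρα))² + 4b/(ρα))) and M* = 2ρQ*/(1 − ρ + ρQ*(α/b)). Then (m_n) converges to M*. -/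
open Filter Topology

/-- A nonnegative sequence that contracts by `r` up to an error `K * r ^ n` tends to zero. -/
theorem tendsto_zero_of_le_mul_add_pow {e : ℕ → ℝ} {r K : ℝ} (hr : 0 < r) (hr1 : r < 1)
    (he : ∀ n, 0 ≤ e n) (hrec : ∀ n, e (n + 1) ≤ r * e n + K * r ^ n) :
    Tendsto e atTop (𝓝 0) := by
  have hbound : ∀ n : ℕ, e n ≤ e 0 * r ^ n + K / r * (n * r ^ n) := by
    intro n
    induction n with
    | zero => simp
    | succ n ih =>
      calc e (n + 1) ≤ r * e n + K * r ^ n := hrec n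
        _ ≤ r * (e 0 * r ^ n + K / r * (n * r ^ n)) + K * r ^ n := by gcongr
        _ = e 0 * r ^ (n + 1) + K / r * ((n + 1 : ℕ) * r ^ (n + 1)) := by
          push_cast
          field_simp
          ring
  have hpow := (tendsto_pow_atTop_nhds_zero_of_lt_one hr.le hr1).const_mul (e 0)
  have hmul := (tendsto_self_mul_const_pow_of_lt_one hr.le hr1).const_mul (K / r)
  have hsum := hpow.add hmul
  simp only [mul_zero, add_zero] at hsum
  exact squeeze_zero he hbound hsum

theorem abs_div_one_add_sub_le {k c x y : ℝ} (hk : 0 ≤ k) (hc : 0 ≤ c) (hx : 0 ≤ x)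
    (hy : 0 ≤ y) :
    |k * x / (1 + c * x) - k * y / (1 + c * y)| ≤ k * |x - y| := by
  have hx' : 1 ≤ 1 + c * x := le_add_of_nonneg_right (by positivity)
  have hy' : 1 ≤ 1 + c * y := le_add_of_nonneg_right (by positivity)
  have hpos : 0 < (1 + c * x) * (1 + c * y) := by positivity
  have heq : k * x / (1 + c * x) - k * y / (1 + c * y) =
      k * (x - y) / ((1 + c * x) * (1 + c * y)) := by
    field_simp
    ring
  rw [heq, abs_div, abs_mul, abs_of_nonneg hk, abs_of_pos hpos]
  exact div_le_self (by positivity) (one_le_mul_of_one_le_of_one_le hx' hy')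

/-- The sequence `m` converges whenever `Q` is a positive fixed point of the recursion for `q`. -/
theorem tendsto_of_fixedPoint {ρ c Q : ℝ} (hρ : 0 < ρ) (hρ1 : ρ < 1) (hc : 0 < c)
    (hQ : 0 < Q) (hfix : Q = 1 + ρ * Q / (1 + ρ * Q * c)) {q m : ℕ → ℝ} (hq0 : 0 ≤ q 0)
    (hqrec : ∀ n, q (n + 1) = 1 + ρ * q n / (1 + ρ * q n * c))
    (hmrec : ∀ n, m (n + 1) = ρ * (m n + 2 * q n) / (1 + ρ * q n * c)) :
    Tendsto m atTop (𝓝 (2 * ρ * Q / (1 - ρ + ρ * Q * c))) := by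
  have hqnonneg : ∀ n, 0 ≤ q n := by
    intro n
    induction n with
    | zero => exact hq0
    | succ n ih =>
      rw [hqrec]
      positivity
  have hqstep : ∀ n, |q (n + 1) - Q| ≤ ρ * |q n - Q| := by
    intro n
    have h := abs_div_one_add_sub_le hρ.le (mul_pos hρ hc).le (hqnonneg n) hQ.le
    rw [mul_right_comm ρ c, mul_right_comm ρ c] at h
    rw [hqrec]
    nth_rewrite 1 [hfix]
    rwa [add_sub_add_left_eq_sub]
  have hqgeom : ∀ n, |q n - Q| ≤ |q 0 - Q| * ρ ^ n := by
    intro n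
    induction n with
    | zero => simp
    | succ n ih =>
      calc |q (n + 1) - Q| ≤ ρ * |q n - Q| := hqstep n
        _ ≤ ρ * (|q 0 - Q| * ρ ^ n) := by gcongr
        _ = |q 0 - Q| * ρ ^ (n + 1) := by ring
  have hden : 0 < 1 - ρ + ρ * Q * c := by
    have : 0 < ρ * Q * c := by positivity
    linarith
  set M := 2 * ρ * Q / (1 - ρ + ρ * Q * c)
  have hMpos : 0 < M := by positivity
  have hMfix : M * (1 - ρ + ρ * Q * c) = 2 * ρ * Q := div_mul_cancel₀ _ hden.ne'
  have hQden : 0 < 1 + ρ * Q * c := by positivity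
  rw [tendsto_iff_norm_sub_tendsto_zero]
  refine tendsto_zero_of_le_mul_add_pow (K := (ρ * c * M + 2) * (ρ * |q 0 - Q|)) hρ hρ1
    (fun n => norm_nonneg _) fun n => ?_
  have hqn := hqnonneg n
  have hge : 1 ≤ 1 + ρ * q n * c := le_add_of_nonneg_right (by positivity)
  have hpos : 0 < 1 + ρ * q n * c := by positivity
  have hQc : 1 ≤ 1 + ρ * Q * c := le_add_of_nonneg_right (by positivity)
  have hMeq : M = ρ * (M + 2 * Q) / (1 + ρ * Q * c) := by
    rw [eq_div_iff hQden.ne']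
    linarith
  have hdecomp : m (n + 1) - M = ρ / (1 + ρ * q n * c) * (m n - M) +
      (ρ * M / (1 + ρ * q n * c) - ρ * M / (1 + ρ * Q * c)) + 2 * (q (n + 1) - Q) := by
    have hqQ : q (n + 1) - Q =
        ρ * q n / (1 + ρ * q n * c) - ρ * Q / (1 + ρ * Q * c) := by
      rw [hqrec]
      linarith
    rw [hqQ, hmrec]
    nth_rewrite 1 [hMeq]
    ring
  have hfirst : |ρ / (1 + ρ * q n * c) * (m n - M)| ≤ ρ * |m n - M| := by
    rw [abs_mul, abs_of_pos (div_pos hρ hpos)]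
    gcongr
    exact div_le_self hρ.le hge
  have hsecond : |ρ * M / (1 + ρ * q n * c) - ρ * M / (1 + ρ * Q * c)| ≤
      ρ * c * M * (ρ * |q n - Q|) := by
    have heq : ρ * M / (1 + ρ * q n * c) - ρ * M / (1 + ρ * Q * c) =
        ρ * c * M * ρ * (Q - q n) / ((1 + ρ * q n * c) * (1 + ρ * Q * c)) := by
      field_simp
      ring
    rw [heq, abs_div, abs_mul, abs_of_pos (by positivity : 0 < ρ * c * M * ρ),
      abs_of_pos (mul_pos hpos hQden), abs_sub_comm, ← mul_assoc]
    exact div_le_self (by positivity) (one_le_mul_of_one_le_of_one_le hge hQc)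
  have hthird : |2 * (q (n + 1) - Q)| ≤ 2 * (ρ * |q n - Q|) := by
    rw [abs_mul, abs_two]
    exact mul_le_mul_of_nonneg_left (hqstep n) zero_le_two
  calc ‖m (n + 1) - M‖ = |m (n + 1) - M| := rfl
    _ ≤ ρ * |m n - M| + ρ * c * M * (ρ * |q n - Q|) + 2 * (ρ * |q n - Q|) := by
      rw [hdecomp]
      exact (abs_add_three _ _ _).trans (add_le_add (add_le_add hfirst hsecond) hthird)
    _ = ρ * |m n - M| + (ρ * c * M + 2) * (ρ * |q n - Q|) := by ring
    _ ≤ ρ * |m n - M| + (ρ * c * M + 2) * (ρ * (|q 0 - Q| * ρ ^ n)) := by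
      gcongr
      exact hqgeom n
    _ = ρ * ‖m n - M‖ + (ρ * c * M + 2) * (ρ * |q 0 - Q|) * ρ ^ n := by
      rw [Real.norm_eq_abs]
      ring


/-- Convergence (Lemma 3.1): the time-reversed sequence `m_n` of the backward
recursion `M_t = ρ(M_{t+1} + 2Q_{t+1})/(1 + ρQ_{t+1}(α/b))` with `m_0 = 0`
converges to the steady state `M* = 2ρQ*/(1 − ρ + ρQ*(α/b))` of equation (17). -/
theorem stmt_12 (ρ α b : ℝ) (hρ : 0 < ρ) (hρ1 : ρ < 1) (hα : 0 < α) (hb : 0 < b)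
    (q m : ℕ → ℝ) (hq0 : q 0 = 1)
    (hqrec : ∀ n, q (n + 1) = 1 + ρ * q n / (1 + ρ * q n * (α / b)))
    (hm0 : m 0 = 0)
    (hmrec : ∀ n, m (n + 1) = ρ * (m n + 2 * q n) / (1 + ρ * q n * (α / b))) :
    Filter.Tendsto m Filter.atTop (nhds
      (2 * ρ * ((1 / 2) * (1 - b * (1 - ρ) / (ρ * α) +
          Real.sqrt ((1 - b * (1 - ρ) / (ρ * α)) ^ 2 + 4 * b / (ρ * α)))) /
        (1 - ρ + ρ * ((1 / 2) * (1 - b * (1 - ρ) / (ρ * α) +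
          Real.sqrt ((1 - b * (1 - ρ) / (ρ * α)) ^ 2 + 4 * b / (ρ * α)))) *
          (α / b)))) := by
  set B := 1 - b * (1 - ρ) / (ρ * α) with hB
  set S := Real.sqrt (B ^ 2 + 4 * b / (ρ * α)) with hS
  have hdisc : 0 < 4 * b / (ρ * α) := by positivity
  have hsq : S ^ 2 = B ^ 2 + 4 * b / (ρ * α) := Real.sq_sqrt (by positivity)
  have hBS : |B| < S := by
    rw [hS, ← Real.sqrt_sq_eq_abs]
    exact Real.sqrt_lt_sqrt (sq_nonneg B) (lt_add_of_pos_right _ hdisc)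
  have hQ : 0 < 1 / 2 * (B + S) := by linarith [neg_abs_le B]
  have hc : 0 < α / b := div_pos hα hb
  refine tendsto_of_fixedPoint hρ hρ1 hc hQ ?_ (hq0 ▸ zero_le_one) hqrec hmrec
  have hquad : (1 / 2 * (B + S)) ^ 2 = B * (1 / 2 * (B + S)) + b / (ρ * α) := by
    linear_combination (1 / 4) * hsq
  generalize 1 / 2 * (B + S) = Q at hQ hquad ⊢
  have hden : 0 < 1 + ρ * Q * (α / b) := by positivity
  rw [hB] at hquad
  field_simp at hquad ⊢
  linarith
end

section
/- Fix real parameters ρ, α, b, Q with 0 < ρ < 1, α > 0, b > 0, Q > 0, and set M = 2ρQ/(1 − ρ + ρQ(α/b)). Let (W(t))_{t≥0} satisfy W(0) = 0 and W(t+1) = W(t) + 1 − (α/b)·(ρM + 2ρQ(W(t)+1))/(2 + 2ρQ(α/b)). Then W(t) converges as t → ∞, and its limit is W̄ = (1−ρ)(1 + ρQ(α/b)) / (ρQ((α/b)(1−ρ) + ρQ(α/b)²)). -/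
/-- Steady-state vehicle response time (23) of Remark 3.1: under the
infinite-horizon optimal dynamic price with the steady-state Riccati
coefficients `Q` and `M = 2ρQ/(1 − ρ + ρQ(α/b))`, the expected vehicle
response time converges to `W̄`. -/
theorem stmt_14 (ρ α b Q : ℝ) (hρ : 0 < ρ) (hρ1 : ρ < 1) (hα : 0 < α)
    (hb : 0 < b) (hQ : 0 < Q)
    (M : ℝ) (hM : M = 2 * ρ * Q / (1 - ρ + ρ * Q * (α / b)))
    (W : ℕ → ℝ) (hW0 : W 0 = 0)
    (hWrec : ∀ t, W (t + 1) = W t + 1 -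
      (α / b) * ((ρ * M + 2 * ρ * Q * (W t + 1)) / (2 + 2 * ρ * Q * (α / b)))) :
    Filter.Tendsto W Filter.atTop (nhds
      ((1 - ρ) * (1 + ρ * Q * (α / b)) /
        (ρ * Q * ((α / b) * (1 - ρ) + ρ * Q * (α / b) ^ 2)))) := by
  have hc : 0 < α / b := div_pos hα hb
  generalize α / b = c at *
  subst hM
  have hk : 0 < ρ * Q * c := by positivity
  have hden : 0 < 1 - ρ + ρ * Q * c := by linarith
  set L := (1 - ρ) * (1 + ρ * Q * c) / (ρ * Q * (c * (1 - ρ) + ρ * Q * c ^ 2)) with hL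
  have hL' : L = (1 - ρ) * (1 + ρ * Q * c) / (ρ * Q * c * (1 - ρ + ρ * Q * c)) := by
    rw [hL]; congr 1; ring
  have hstep : ∀ t, W (t + 1) - L = (1 + ρ * Q * c)⁻¹ * (W t - L) := by
    intro t
    have h1 : 1 + ρ * Q * c ≠ 0 := by positivity
    have h2 : 2 + 2 * ρ * Q * c = 2 * (1 + ρ * Q * c) := by ring
    rw [hWrec, hL', h2]
    obtain ⟨D, hD⟩ : ∃ D, D = 1 - ρ + ρ * Q * c := ⟨_, rfl⟩
    have h3 : D ≠ 0 := hD ▸ hden.ne'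
    rw [← hD]
    field_simp
    rw [hD]
    ring
  have hclosed : ∀ t, W t = (1 + ρ * Q * c)⁻¹ ^ t * (W 0 - L) + L := by
    intro t
    induction t with
    | zero => ring
    | succ t ih =>
      rw [← sub_eq_iff_eq_add, hstep, ih]
      ring
  have hpow := tendsto_pow_atTop_nhds_zero_of_lt_one
    (inv_nonneg.2 (by linarith : 0 ≤ 1 + ρ * Q * c))
    (inv_lt_one_of_one_lt₀ (by linarith : 1 < 1 + ρ * Q * c))
  rw [funext hclosed]
  simpa using (hpow.mul_const (W 0 - L)).add_const L
end

section
/- Fix real parameters ρ, α, b, Q with 0 < ρ < 1, α > 0, b > 0, Q > 0, and set M = 2ρQ/(1 − ρ + ρQ(α/b)). Let (W(t))_{t≥0} satisfy W(0) = 0 and W(t+1) = W(t) + 1 − (α/b)·p(t), where p(t) = (ρM + 2ρQ(W(t)+1))/(2 + 2ρQ(α/b)). Then p(t) converges to b/α as t → ∞; in particular, if α ≥ 1 then the limit of p(t) is at most b. -/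
/-- Price convergence (24) of Remark 3.1: under the infinite-horizon optimal
dynamic pricing with steady-state Riccati coefficients `Q` and
`M = 2ρQ/(1 − ρ + ρQ(α/b))`, the optimal price `p(t)` converges to `b/α`;
in particular, if `α ≥ 1` the limit is at most `b`. -/
theorem stmt_15 (ρ α b Q : ℝ) (hρ : 0 < ρ) (hρ1 : ρ < 1) (hα : 0 < α)
    (hb : 0 < b) (hQ : 0 < Q)
    (M : ℝ) (hM : M = 2 * ρ * Q / (1 - ρ + ρ * Q * (α / b)))
    (W p : ℕ → ℝ) (hW0 : W 0 = 0)
    (hp : ∀ t, p t = (ρ * M + 2 * ρ * Q * (W t + 1)) / (2 + 2 * ρ * Q * (α / b)))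
    (hWrec : ∀ t, W (t + 1) = W t + 1 - (α / b) * p t) :
    Filter.Tendsto p Filter.atTop (nhds (b / α)) ∧
    (1 ≤ α → b / α ≤ b) := by
  have hD : 0 < 2 + 2 * ρ * Q * (α / b) := by positivity
  have hstep : ∀ t, p (t + 1) - b / α = 2 / (2 + 2 * ρ * Q * (α / b)) * (p t - b / α) := by
    intro t
    have hdiff : p (t + 1) = p t + 2 * ρ * Q * (1 - (α / b) * p t) / (2 + 2 * ρ * Q * (α / b)) := by
      rw [hp (t + 1), hWrec t]
      nth_rewrite 2 [hp t]
      rw [← add_div]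
      ring
    rw [hdiff]
    field_simp
    ring
  have hgeom : ∀ t, p t = b / α + (2 / (2 + 2 * ρ * Q * (α / b))) ^ t * (p 0 - b / α) := by
    intro t
    induction t with
    | zero => simp
    | succ t ih =>
      have h := hstep t
      rw [ih] at h
      rw [pow_succ]
      linear_combination h
  refine ⟨?_, fun h => div_le_self hb.le h⟩
  have hlt : 2 / (2 + 2 * ρ * Q * (α / b)) < 1 := by
    rw [div_lt_one hD]
    have : 0 < 2 * ρ * Q * (α / b) := by positivity
    linarith
  have hlim := ((tendsto_pow_atTop_nhds_zero_of_lt_one (by positivity) hlt).mul_const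
    (p 0 - b / α)).const_add (b / α)
  rw [zero_mul, add_zero] at hlim
  exact hlim.congr fun t => (hgeom t).symm
end

section
/- Let γ ≥ 0, N ≥ 1 a natural number, and let w₁, …, w_m be real numbers with 0 ≤ wᵢ ≤ γ for all i, and total S = Σᵢ wᵢ. Then there exists a partition of the index set {1, …, m} into at most N consecutive (contiguous) blocks such that the sum of the wᵢ over each block is at most S/N + γ. -/
/-- The last index up to `m` at which the partial sum of `w` is at most `t`. -/
noncomputable def lastPrefix (w : ℕ → ℝ) (m : ℕ) (t : ℝ) : ℕ :=
  open Classical in Nat.findGreatest (fun n => ∑ i ∈ Finset.Ioc 0 n, w i ≤ t) m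

theorem lastPrefix_le (w : ℕ → ℝ) (m : ℕ) (t : ℝ) : lastPrefix w m t ≤ m := by
  classical exact Nat.findGreatest_le m

theorem le_lastPrefix {w : ℕ → ℝ} {m n : ℕ} {t : ℝ} (hn : n ≤ m)
    (h : ∑ i ∈ Finset.Ioc 0 n, w i ≤ t) : n ≤ lastPrefix w m t := by
  classical exact Nat.le_findGreatest hn h

theorem sum_lastPrefix_le (w : ℕ → ℝ) (m : ℕ) {t : ℝ} (ht : 0 ≤ t) :
    ∑ i ∈ Finset.Ioc 0 (lastPrefix w m t), w i ≤ t := by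
  classical
  exact Nat.findGreatest_spec (P := fun n => ∑ i ∈ Finset.Ioc 0 n, w i ≤ t)
    (Nat.zero_le m) (by simpa using ht)

theorem lastPrefix_mono (w : ℕ → ℝ) (m : ℕ) {s t : ℝ} (hs : 0 ≤ s) (hst : s ≤ t) :
    lastPrefix w m s ≤ lastPrefix w m t :=
  le_lastPrefix (lastPrefix_le w m s) ((sum_lastPrefix_le w m hs).trans hst)

theorem le_sum_lastPrefix_add {w : ℕ → ℝ} {m : ℕ} {γ t : ℝ} (hγ : 0 ≤ γ)
    (hw : ∀ i ∈ Finset.Icc 1 m, w i ≤ γ) (ht : t ≤ ∑ i ∈ Finset.Ioc 0 m, w i) :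
    t ≤ ∑ i ∈ Finset.Ioc 0 (lastPrefix w m t), w i + γ := by
  rcases (lastPrefix_le w m t).eq_or_lt with h | h
  · rw [h]
    linarith
  · by_contra! hlt
    have hstep := Finset.sum_Ioc_succ_top (Nat.zero_le (lastPrefix w m t)) w
    have hwi := hw (lastPrefix w m t + 1) (Finset.mem_Icc.2 ⟨by lia, h⟩)
    have := le_lastPrefix (w := w) (t := t) (Nat.succ_le_of_lt h) (by
      rw [Nat.succ_eq_add_one, hstep]
      linarith)
    lia

/-- Tour-splitting (SplitTours): weights `w₁, …, w_m` with `0 ≤ wᵢ ≤ γ` and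
total `S` can be partitioned into at most `N` consecutive blocks (given by cut
points `0 = c 0 ≤ c 1 ≤ ⋯ ≤ c k = m`, block `j` covering indices in
`(c j, c (j+1)]`) so that each block's sum is at most `S/N + γ`. -/
theorem stmt_17 (γ : ℝ) (hγ : 0 ≤ γ) (N : ℕ) (hN : 1 ≤ N) (m : ℕ)
    (w : ℕ → ℝ) (hw : ∀ i ∈ Finset.Icc 1 m, 0 ≤ w i ∧ w i ≤ γ) :
    ∃ k : ℕ, k ≤ N ∧ ∃ c : ℕ → ℕ, c 0 = 0 ∧ c k = m ∧
      (∀ j < k, c j ≤ c (j + 1)) ∧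
      ∀ j < k, (∑ i ∈ Finset.Ioc (c j) (c (j + 1)), w i) ≤
        (∑ i ∈ Finset.Icc 1 m, w i) / (N : ℝ) + γ := by
  have hIcc : Finset.Icc 1 m = Finset.Ioc 0 m := by
    ext i
    simp only [Finset.mem_Icc, Finset.mem_Ioc]
    lia
  have hS : 0 ≤ ∑ i ∈ Finset.Icc 1 m, w i := Finset.sum_nonneg fun i hi => (hw i hi).1
  have hN0 : (0 : ℝ) < N := by exact_mod_cast hN
  set q : ℝ := (∑ i ∈ Finset.Icc 1 m, w i) / (N : ℝ) with hq
  have hq0 : 0 ≤ q := by positivity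
  have hNq : N * q = ∑ i ∈ Finset.Ioc 0 m, w i := by
    rw [hq, hIcc]
    field_simp
  let c : ℕ → ℕ := fun j => if j = 0 then 0 else lastPrefix w m (j * q)
  have hc_succ (j : ℕ) : c (j + 1) = lastPrefix w m ((j + 1 : ℕ) * q) :=
    if_neg j.succ_ne_zero
  have hmono (j : ℕ) : c j ≤ c (j + 1) := by
    cases j with
    | zero => exact Nat.zero_le _
    | succ j =>
      rw [hc_succ, hc_succ]
      exact lastPrefix_mono w m (by positivity) (by gcongr; lia)
  have hlower (j : ℕ) (hj : j < N) : j * q ≤ ∑ i ∈ Finset.Ioc 0 (c j), w i + γ := by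
    cases j with
    | zero => simpa [c] using hγ
    | succ j =>
      rw [hc_succ]
      refine le_sum_lastPrefix_add hγ (fun i hi => (hw i hi).2) ?_
      rw [← hNq]
      gcongr
  refine ⟨N, le_rfl, c, rfl, ?_, fun j _ => hmono j, fun j hj => ?_⟩
  · have hcN : c N = lastPrefix w m (N * q) := if_neg (by lia)
    rw [hcN]
    exact (lastPrefix_le w m _).antisymm (le_lastPrefix le_rfl hNq.ge)
  · have hsplit := Finset.sum_Ioc_consecutive w (Nat.zero_le (c j)) (hmono j)
    have hupper : ∑ i ∈ Finset.Ioc 0 (c (j + 1)), w i ≤ (j + 1 : ℕ) * q := by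
      rw [hc_succ]
      exact sum_lastPrefix_le w m (by positivity)
    have := hlower j hj
    push_cast at hupper
    linarith
end
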